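/- Let A, B ∈ ℝ^{d×m} both be semi-orthonormal and let A⊥ be a complement basis of A. Then for every orthogonal matrix R ∈ ℝ^{m×m} (RᵀR = I_m), ‖A⊥ᵀB‖_F² ≤ ‖AR − B‖_F². -/

import Mathlib

open Matrix

/-- The Frobenius norm of a real matrix. -/
noncomputable def frobNorm {d k : ℕ} (A : Matrix (Fin d) (Fin k) ℝ) : ℝ :=
  Real.sqrt (∑ i, ∑ j, A i j ^ 2)

theorem frobNorm_sq_eq_trace {d k : ℕ} (X : Matrix (Fin d) (Fin k) ℝ) :
    frobNorm X ^ 2 = (Xᵀ * X).trace := by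
  unfold frobNorm
  have h : 0 ≤ ∑ i, ∑ j, X i j ^ 2 :=
    Finset.sum_nonneg fun i _ => Finset.sum_nonneg fun j _ => sq_nonneg _
  rw [Real.sq_sqrt h, Finset.sum_comm]
  simp [Matrix.trace, Matrix.mul_apply, sq]

theorem frobNorm_proj_le {d k m : ℕ} (P : Matrix (Fin d) (Fin k) ℝ)
    (X : Matrix (Fin d) (Fin m) ℝ) (hP : Pᵀ * P = 1) :
    frobNorm (Pᵀ * X) ^ 2 ≤ frobNorm X ^ 2 := by
  have key : (X - P * (Pᵀ * X))ᵀ * (X - P * (Pᵀ * X)) =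
      Xᵀ * X - (Pᵀ * X)ᵀ * (Pᵀ * X) := by
    have h : Pᵀ * (X - P * (Pᵀ * X)) = 0 := by
      rw [Matrix.mul_sub, ← Matrix.mul_assoc Pᵀ P, hP, Matrix.one_mul, sub_self]
    rw [Matrix.transpose_sub, Matrix.sub_mul, Matrix.transpose_mul P, Matrix.mul_assoc _ Pᵀ, h,
      Matrix.mul_zero, sub_zero, Matrix.mul_sub, Matrix.transpose_mul, Matrix.transpose_transpose,
      Matrix.mul_assoc Xᵀ P]
  have h2 := congrArg Matrix.trace key
  rw [Matrix.trace_sub, ← frobNorm_sq_eq_trace, ← frobNorm_sq_eq_trace,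
    ← frobNorm_sq_eq_trace] at h2
  linarith [sq_nonneg (frobNorm (X - P * (Pᵀ * X)))]

/-- For semi-orthonormal `A, B ∈ ℝ^{d×m}` with `A⊥` a complement basis of `A`,
and every orthogonal `R ∈ ℝ^{m×m}`: `‖A⊥ᵀB‖_F² ≤ ‖AR − B‖_F²`. -/
theorem sin_principal_angles_le_procrustes
    (d m : ℕ) (hm : 0 < m) (hmd : m < d)
    (A B : Matrix (Fin d) (Fin m) ℝ) (Ap : Matrix (Fin d) (Fin (d - m)) ℝ)
    (hA : Aᵀ * A = 1) (hB : Bᵀ * B = 1) (hAp : Apᵀ * Ap = 1) (hperp : Aᵀ * Ap = 0)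
    (R : Matrix (Fin m) (Fin m) ℝ) (hR : Rᵀ * R = 1) :
    frobNorm (Apᵀ * B) ^ 2 ≤ frobNorm (A * R - B) ^ 2 := by
  have h0 : Apᵀ * A = 0 := by
    have := congrArg Matrix.transpose hperp
    simpa using this
  have h1 : Apᵀ * (A * R - B) = -(Apᵀ * B) := by
    rw [Matrix.mul_sub, ← Matrix.mul_assoc, h0, Matrix.zero_mul, zero_sub]
  have h2 := frobNorm_proj_le Ap (A * R - B) hAp
  rw [h1] at h2
  have h3 : frobNorm (-(Apᵀ * B)) = frobNorm (Apᵀ * B) := by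
    simp [frobNorm]
  rwa [h3] at h2
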